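/- Let K be a number field. Then ∑_{𝔭, N𝔭 ≤ x} 1/N𝔭 ∼ log log x as x → ∞, where the sum is over all nonzero prime ideals 𝔭 of the ring of integers of K with absolute norm at most x; that is, the ratio of the two sides tends to 1. -/

import Mathlib

open Filter Real NumberField

namespace MertensAux
open Topology

variable (K : Type*) [Field K] [NumberField K]

noncomputable def a (n : ℕ) : ℝ := Nat.card {I : Ideal (𝓞 K) // Ideal.absNorm I = n}

noncomputable def Z (s : ℝ) : ℝ := ∑' n : ℕ, a K n * (n : ℝ) ^ (-s)

lemma a_nonneg (n : ℕ) : 0 ≤ a K n := Nat.cast_nonneg _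

lemma term_nonneg (s : ℝ) (n : ℕ) : 0 ≤ a K n * (n : ℝ) ^ (-s) :=
  mul_nonneg (a_nonneg K n) (by positivity)

lemma term_eq {s : ℝ} (hs : 1 < s) (n : ℕ) :
    LSeries.term (fun n ↦ (Nat.card {I : Ideal (𝓞 K) // Ideal.absNorm I = n} : ℂ)) s n
      = ((a K n * (n : ℝ) ^ (-s) : ℝ) : ℂ) := by
  rcases eq_or_ne n 0 with rfl | hn
  · have : (0:ℝ) ^ (-s) = 0 := Real.zero_rpow (by linarith)
    simp [this]
  · rw [LSeries.term_of_ne_zero hn, a, Real.rpow_neg (by positivity)]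
    push_cast
    rw [Complex.ofReal_cpow (by positivity)]
    push_cast
    rw [div_eq_mul_inv]

lemma zeta_eq {s : ℝ} (hs : 1 < s) : dedekindZeta K s = ((Z K s : ℝ) : ℂ) := by
  rw [dedekindZeta, LSeries, Z, Complex.ofReal_tsum]
  exact tsum_congr (term_eq K hs)

lemma Z_tendsto : Tendsto (fun s : ℝ ↦ (s - 1) * Z K s) (𝓝[>] 1) (𝓝 (dedekindZeta_residue K)) := by
  have h := tendsto_sub_one_mul_dedekindZeta_nhdsGT K
  have h2 := (Complex.continuous_re.tendsto _).comp h
  rw [Complex.ofReal_re] at h2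
  refine h2.congr' ?_
  filter_upwards [self_mem_nhdsWithin] with s hs
  have : (((s:ℂ) - 1) * dedekindZeta K s) = (((s - 1) * Z K s : ℝ) : ℂ) := by
    rw [zeta_eq K hs]; push_cast; ring
  simp only [Function.comp_apply]
  rw [this, Complex.ofReal_re]

lemma Z_summable {s : ℝ} (hs : 1 < s) : Summable (fun n : ℕ ↦ a K n * (n : ℝ) ^ (-s)) := by
  have h1 : ∀ᶠ t in 𝓝[>] (1:ℝ), 0 < (t - 1) * Z K t :=
    (Z_tendsto K).eventually (lt_mem_nhds (dedekindZeta_residue_pos K))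
  have h2 : ∀ᶠ t in 𝓝[>] (1:ℝ), t < s := nhdsWithin_le_nhds (gt_mem_nhds hs)
  obtain ⟨t, ⟨h1, h2⟩, h3⟩ := ((h1.and h2).and self_mem_nhdsWithin).exists
  have h3 : 1 < t := h3
  have ht : Summable (fun n : ℕ ↦ a K n * (n : ℝ) ^ (-t)) := by
    by_contra hc
    rw [Z, tsum_eq_zero_of_not_summable hc] at h1
    simp at h1
  refine Summable.of_nonneg_of_le (term_nonneg K s) (fun n ↦ ?_) ht
  refine mul_le_mul_of_nonneg_left ?_ (a_nonneg K n)
  rcases Nat.eq_zero_or_pos n with rfl | hn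
  · rw [Nat.cast_zero, Real.zero_rpow (by linarith), Real.zero_rpow (by linarith)]
  · exact Real.rpow_le_rpow_of_exponent_le (by exact_mod_cast hn) (by linarith)

variable {K}

lemma sum_ideals_le {s : ℝ} (hs : 1 < s) (F : Finset (Ideal (𝓞 K))) :
    ∑ I ∈ F, (Ideal.absNorm I : ℝ) ^ (-s) ≤ Z K s := by
  classical
  have : ∑ I ∈ F, (Ideal.absNorm I : ℝ) ^ (-s)
      = ∑ n ∈ F.image Ideal.absNorm, ∑ I ∈ F with Ideal.absNorm I = n, (n : ℝ) ^ (-s) := by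
    rw [← Finset.sum_fiberwise_of_maps_to (s := F) (t := F.image Ideal.absNorm)
      (g := Ideal.absNorm) (fun I hI ↦ Finset.mem_image_of_mem _ hI)]
    refine Finset.sum_congr rfl fun n _ ↦ Finset.sum_congr rfl fun I hI ↦ ?_
    rw [(Finset.mem_filter.mp hI).2]
  rw [this]
  refine le_trans (Finset.sum_le_sum fun n _ ↦ ?_)
    ((Z_summable K hs).sum_le_tsum (F.image Ideal.absNorm) (fun n _ ↦ term_nonneg K s n))
  rw [Finset.sum_const, nsmul_eq_mul]
  refine mul_le_mul_of_nonneg_right ?_ (by positivity)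
  rw [a, Nat.cast_le]
  have hfin : Set.Finite {I : Ideal (𝓞 K) | Ideal.absNorm I = n} :=
    Ideal.finite_setOfPred_absNorm_eq n
  have : Nat.card {I : Ideal (𝓞 K) // Ideal.absNorm I = n} = {I : Ideal (𝓞 K) | Ideal.absNorm I = n}.ncard := rfl
  rw [this, ← Set.ncard_coe_finset]
  refine Set.ncard_le_ncard ?_ hfin
  intro I hI
  simpa using (Finset.mem_filter.mp hI).2

lemma one_le_norm {I : Ideal (𝓞 K)} (hI : I ≠ ⊥) : (1 : ℝ) ≤ Ideal.absNorm I := by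
  have : Ideal.absNorm I ≠ 0 := by rwa [Ne, Ideal.absNorm_eq_zero_iff]
  exact_mod_cast Nat.one_le_iff_ne_zero.mpr this

lemma norm_prod (U : Finset (Ideal (𝓞 K))) (s : ℝ) :
    ∏ I ∈ U, (Ideal.absNorm I : ℝ) ^ s = (Ideal.absNorm (∏ I ∈ U, I) : ℝ) ^ s := by
  rw [Real.finsetProd_rpow _ _ (fun _ _ ↦ by positivity), map_prod]
  push_cast
  rfl

lemma prod_one_add (T : Finset (Ideal (𝓞 K))) (s : ℝ) :
    ∏ I ∈ T, (1 + (Ideal.absNorm I : ℝ) ^ s)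
      = ∑ U ∈ T.powerset, (Ideal.absNorm (∏ I ∈ U, I) : ℝ) ^ s := by
  rw [Finset.prod_one_add]
  exact Finset.sum_congr rfl fun U _ ↦ norm_prod U s

lemma factors_prod (U : Finset (Ideal (𝓞 K))) (hU : ∀ I ∈ U, Prime I) :
    UniqueFactorizationMonoid.normalizedFactors (∏ I ∈ U, I) = U.val := by
  have := UniqueFactorizationMonoid.normalizedFactors_prod_of_prime (m := U.val) hU
  rw [← this]
  congr 1
  rw [Finset.prod, Multiset.map_id']

lemma upper {s : ℝ} (hs : 1 < s) (T : Finset (Ideal (𝓞 K))) (hT : ∀ I ∈ T, Prime I) :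
    ∑ I ∈ T, (Ideal.absNorm I : ℝ) ^ (-s) ≤ Real.log (Z K s) + Z K 2 := by
  classical
  have h1 : ∏ I ∈ T, (1 + (Ideal.absNorm I : ℝ) ^ (-s)) ≤ Z K s := by
    rw [prod_one_add]
    have : ∑ U ∈ T.powerset, (Ideal.absNorm (∏ I ∈ U, I) : ℝ) ^ (-s)
        = ∑ J ∈ T.powerset.image (fun U ↦ ∏ I ∈ U, I), (Ideal.absNorm J : ℝ) ^ (-s) := by
      rw [Finset.sum_image]
      intro U hU V hV h
      have hU' : ∀ I ∈ U, Prime I := fun I hI ↦ hT I (Finset.mem_powerset.mp hU hI)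
      have hV' : ∀ I ∈ V, Prime I := fun I hI ↦ hT I (Finset.mem_powerset.mp hV hI)
      apply Finset.val_injective
      rw [← factors_prod U hU', ← factors_prod V hV']
      exact congrArg _ h
    rw [this]
    exact sum_ideals_le hs _
  have hpos : ∀ I ∈ T, 0 < 1 + (Ideal.absNorm I : ℝ) ^ (-s) := fun I _ ↦ by positivity
  have h2 := Real.log_le_log (Finset.prod_pos hpos) h1
  rw [Real.log_prod (fun I hI ↦ (hpos I hI).ne')] at h2
  have h3 := sum_ideals_le (K := K) one_lt_two T
  have h4 : ∑ I ∈ T, (Ideal.absNorm I : ℝ) ^ (-s) ≤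
      ∑ I ∈ T, (Real.log (1 + (Ideal.absNorm I : ℝ) ^ (-s)) + (Ideal.absNorm I : ℝ) ^ (-2 : ℝ)) := by
    refine Finset.sum_le_sum fun I hI ↦ ?_
    have hn : (1 : ℝ) ≤ Ideal.absNorm I := one_le_norm (hT I hI).ne_zero
    have h5 : ((Ideal.absNorm I : ℝ) ^ (-s)) ^ 2 ≤ (Ideal.absNorm I : ℝ) ^ (-2 : ℝ) := by
      rw [← Real.rpow_natCast, ← Real.rpow_mul (by positivity)]
      exact Real.rpow_le_rpow_of_exponent_le hn (by push_cast; linarith)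
    set u := (Ideal.absNorm I : ℝ) ^ (-s)
    have hu : 0 < u := by positivity
    have h6 := Real.one_sub_inv_le_log_of_pos (show 0 < 1 + u by positivity)
    have h7 : u - u ^ 2 ≤ 1 - (1 + u)⁻¹ := by
      have : 1 - (1 + u)⁻¹ - (u - u^2) = u ^ 3 / (1 + u) := by field_simp; ring
      have : 0 ≤ u ^ 3 / (1 + u) := by positivity
      linarith
    linarith
  rw [Finset.sum_add_distrib] at h4
  linarith

lemma sq_decomp (I : Ideal (𝓞 K)) (hI : I ≠ ⊥) :
    ∃ (J : Ideal (𝓞 K)) (U : Finset (Ideal (𝓞 K))), (∀ P ∈ U, Prime P) ∧ I = J ^ 2 * ∏ P ∈ U, P := by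
  classical
  suffices h : ∀ m : Multiset (Ideal (𝓞 K)), (∀ P ∈ m, Prime P) →
      ∃ (J : Ideal (𝓞 K)) (U : Finset (Ideal (𝓞 K))), (∀ P ∈ U, Prime P) ∧
        m.prod = J ^ 2 * ∏ P ∈ U, P by
    have := h (UniqueFactorizationMonoid.normalizedFactors I)
      (fun P hP ↦ UniqueFactorizationMonoid.prime_of_normalized_factor P hP)
    rwa [Ideal.prod_normalizedFactors_eq_self hI] at this
  intro m
  induction m using Multiset.induction_on with
  | empty => intro _; exact ⟨1, ∅, by simp, by rw [one_pow, one_mul, Multiset.prod_zero, Finset.prod_empty]⟩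
  | cons P m ih =>
    intro hm
    obtain ⟨J, U, hU, h⟩ := ih fun Q hQ ↦ hm Q (Multiset.mem_cons_of_mem hQ)
    by_cases hP : P ∈ U
    · refine ⟨P * J, U.erase P, fun Q hQ ↦ hU Q (Finset.mem_of_mem_erase hQ), ?_⟩
      rw [Multiset.prod_cons, h, ← Finset.mul_prod_erase U _ hP]
      ring
    · refine ⟨J, insert P U, ?_, ?_⟩
      · intro Q hQ
        rcases Finset.mem_insert.mp hQ with rfl | hQ
        · exact hm _ (Multiset.mem_cons_self _ _)
        · exact hU Q hQ
      · rw [Multiset.prod_cons, h, Finset.prod_insert hP]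
        ring

lemma lower (F T : Finset (Ideal (𝓞 K))) (hF : ∀ I ∈ F, I ≠ ⊥)
    (hT : ∀ P, Prime P → ∀ I ∈ F, P ∣ I → P ∈ T) :
    ∑ I ∈ F, (Ideal.absNorm I : ℝ) ^ (-1 : ℝ) ≤
      Z K 2 * ∏ P ∈ T, (1 + (Ideal.absNorm P : ℝ) ^ (-1 : ℝ)) := by
  classical
  choose! J U hU h using fun (I : Ideal (𝓞 K)) (hI : I ≠ ⊥) ↦ sq_decomp I hI
  calc ∑ I ∈ F, (Ideal.absNorm I : ℝ) ^ (-1 : ℝ)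
      = ∑ I ∈ F, (Ideal.absNorm (J I) : ℝ) ^ (-2 : ℝ) *
          (Ideal.absNorm (∏ P ∈ U I, P) : ℝ) ^ (-1 : ℝ) := by
        refine Finset.sum_congr rfl fun I hI ↦ ?_
        conv_lhs => rw [h I (hF I hI)]
        rw [map_mul, map_pow]
        push_cast
        rw [Real.mul_rpow (by positivity) (by positivity), ← Real.rpow_natCast,
          ← Real.rpow_mul (by positivity)]
        norm_num
    _ = ∑ p ∈ F.image (fun I ↦ (J I, U I)), (Ideal.absNorm p.1 : ℝ) ^ (-2 : ℝ) *
          (Ideal.absNorm (∏ P ∈ p.2, P) : ℝ) ^ (-1 : ℝ) := by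
        rw [Finset.sum_image]
        intro I hI I' hI' he
        rw [h I (hF I hI), h I' (hF I' hI')]
        simp only [Prod.mk.injEq] at he
        rw [he.1, he.2]
    _ ≤ ∑ p ∈ F.image J ×ˢ T.powerset, (Ideal.absNorm p.1 : ℝ) ^ (-2 : ℝ) *
          (Ideal.absNorm (∏ P ∈ p.2, P) : ℝ) ^ (-1 : ℝ) := by
        refine Finset.sum_le_sum_of_subset_of_nonneg ?_ (fun _ _ _ ↦ by positivity)
        intro p hp
        obtain ⟨I, hI, rfl⟩ := Finset.mem_image.mp hp
        refine Finset.mem_product.mpr ⟨Finset.mem_image_of_mem _ hI, Finset.mem_powerset.mpr ?_⟩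
        intro P hP
        refine hT P (hU I (hF I hI) P hP) I hI ?_
        conv_rhs => rw [h I (hF I hI)]
        exact Dvd.dvd.mul_left (Finset.dvd_prod_of_mem _ hP) _
    _ = (∑ J ∈ F.image J, (Ideal.absNorm J : ℝ) ^ (-2 : ℝ)) *
          ∏ P ∈ T, (1 + (Ideal.absNorm P : ℝ) ^ (-1 : ℝ)) := by
        rw [prod_one_add, Finset.sum_product, Finset.sum_mul_sum]
    _ ≤ _ := by
        refine mul_le_mul_of_nonneg_right (sum_ideals_le one_lt_two _) ?_
        exact Finset.prod_nonneg fun _ _ ↦ by positivity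

lemma tendsto_shift {δ : ℝ} (hδ : 0 < δ) :
    Tendsto (fun x : ℝ ↦ 1 + δ / Real.log x) atTop (𝓝[>] 1) := by
  rw [tendsto_nhdsWithin_iff]
  constructor
  · simpa using (Real.tendsto_log_atTop.const_div_atTop δ).const_add 1
  · filter_upwards [eventually_gt_atTop 1] with x hx
    have := Real.log_pos hx
    simp only [Set.mem_Ioi]
    have : 0 < δ / Real.log x := by positivity
    linarith

variable (K) in
lemma Z_shift {δ : ℝ} (hδ : 0 < δ) :
    Tendsto (fun x : ℝ ↦ δ / Real.log x * Z K (1 + δ / Real.log x)) atTop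
      (𝓝 (dedekindZeta_residue K)) := by
  refine ((Z_tendsto K).comp (tendsto_shift hδ)).congr fun x ↦ ?_
  simp

lemma rpow_shift {δ x y : ℝ} (hx : 1 < x) (hy : 0 < y) :
    y ^ (-(1 + δ / Real.log x)) = y ^ (-1 : ℝ) * Real.exp (-(δ * (Real.log y / Real.log x))) := by
  have hL := Real.log_pos hx
  rw [neg_add, Real.rpow_add hy, Real.rpow_def_of_pos hy (-(δ / Real.log x))]
  congr 2
  field_simp

variable (K) in
lemma S_lower : ∃ c : ℝ, 0 < c ∧ ∀ᶠ x : ℝ in atTop,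
    c * Real.log x ≤ ∑ n ∈ Finset.range (⌊x⌋₊ + 1), a K n * (n : ℝ) ^ (-1 : ℝ) := by
  have hc := dedekindZeta_residue_pos K
  set c := dedekindZeta_residue K
  refine ⟨c / 32, by positivity, ?_⟩
  have h1 := (Z_shift K (show (0:ℝ) < 4 by norm_num)).eventually
    (lt_mem_nhds (show 3 / 4 * c < c by linarith))
  have h2 := (Z_shift K (show (0:ℝ) < 2 by norm_num)).eventually
    (gt_mem_nhds (show c < 5 / 4 * c by linarith))
  filter_upwards [h1, h2, eventually_gt_atTop 1] with x h1 h2 hx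
  have hL := Real.log_pos hx
  set L := Real.log x with hLdef
  have hs4 : 1 < 1 + 4 / L := by have : 0 < 4 / L := by positivity
                                 linarith
  have hs2 : 1 < 1 + 2 / L := by have : 0 < 2 / L := by positivity
                                 linarith
  have he : Real.exp (-2) ≤ 1 / 4 := by
    have h := Real.add_one_le_exp (1:ℝ)
    have h' : Real.exp 2 = Real.exp 1 * Real.exp 1 := by rw [← Real.exp_add]; norm_num
    rw [Real.exp_neg, inv_eq_one_div]
    apply one_div_le_one_div_of_le (by norm_num)
    nlinarith
  have hsplit : Z K (1 + 4 / L) ≤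
      ∑ n ∈ Finset.range (⌊x⌋₊ + 1), a K n * (n : ℝ) ^ (-1 : ℝ) + 1 / 4 * Z K (1 + 2 / L) := by
    have hs := Z_summable K hs4
    rw [Z, ← hs.sum_add_tsum_nat_add (⌊x⌋₊ + 1)]
    refine add_le_add (Finset.sum_le_sum fun n _ ↦ ?_) ?_
    · refine mul_le_mul_of_nonneg_left ?_ (a_nonneg K n)
      rcases Nat.eq_zero_or_pos n with rfl | hn
      · rw [Nat.cast_zero, Real.zero_rpow (by linarith), Real.zero_rpow (by norm_num)]
      · exact Real.rpow_le_rpow_of_exponent_le (by exact_mod_cast hn) (by linarith)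
    · have hs' := Z_summable K hs2
      have h3 : ∑' n : ℕ, a K (n + (⌊x⌋₊ + 1)) * ((n + (⌊x⌋₊ + 1) : ℕ) : ℝ) ^ (-(1 + 2 / L))
          ≤ Z K (1 + 2 / L) := by
        rw [Z, ← hs'.sum_add_tsum_nat_add (⌊x⌋₊ + 1)]
        have : 0 ≤ ∑ n ∈ Finset.range (⌊x⌋₊ + 1), a K n * (n : ℝ) ^ (-(1 + 2 / L)) :=
          Finset.sum_nonneg fun n _ ↦ term_nonneg K _ n
        linarith
      refine le_trans ?_ (mul_le_mul_of_nonneg_left h3 (by norm_num))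
      rw [← tsum_mul_left]
      have hA := (summable_nat_add_iff (f := fun n : ℕ ↦ a K n * (n : ℝ) ^ (-(1 + 4 / L)))
        (⌊x⌋₊ + 1)).mpr hs
      have hB := (summable_nat_add_iff (f := fun n : ℕ ↦ a K n * (n : ℝ) ^ (-(1 + 2 / L)))
        (⌊x⌋₊ + 1)).mpr hs'
      refine Summable.tsum_le_tsum (fun n ↦ ?_) hA (hB.mul_left _)
      set m := n + (⌊x⌋₊ + 1) with hm
      have hmx : x < m := by
        have := Nat.lt_floor_add_one x
        rw [hm]; push_cast
        have : (0:ℝ) ≤ n := by positivity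
        linarith
      have hm0 : (0:ℝ) < m := by linarith
      have hlog : 1 ≤ Real.log m / L := by
        rw [one_le_div hL]
        exact Real.log_le_log (by linarith) hmx.le
      rw [rpow_shift hx hm0, rpow_shift hx hm0]
      have : Real.exp (-(4 * (Real.log m / L))) ≤ 1 / 4 * Real.exp (-(2 * (Real.log m / L))) := by
        refine le_trans ?_ (mul_le_mul_of_nonneg_right he (Real.exp_pos _).le)
        rw [← Real.exp_add]
        apply Real.exp_le_exp.mpr
        linarith
      have h5 : 0 ≤ a K m * (m:ℝ) ^ (-1:ℝ) := term_nonneg K 1 m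
      calc _ = a K m * (m:ℝ) ^ (-1:ℝ) * Real.exp (-(4 * (Real.log m / L))) := by ring
        _ ≤ a K m * (m:ℝ) ^ (-1:ℝ) * (1 / 4 * Real.exp (-(2 * (Real.log m / L)))) :=
          mul_le_mul_of_nonneg_left this h5
        _ = _ := by ring
  have h1' : 3 / 16 * c * L < Z K (1 + 4 / L) := by
    rw [div_mul_eq_mul_div 4 L, lt_div_iff₀ hL] at h1
    linarith
  have h2' : Z K (1 + 2 / L) < 5 / 8 * c * L := by
    rw [div_mul_eq_mul_div, div_lt_iff₀ hL] at h2
    linarith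
  have : 0 < c * L := by positivity
  linarith

variable (K) in
lemma finite_le (n : ℕ) : {I : Ideal (𝓞 K) | Ideal.absNorm I ≤ n}.Finite :=
  Ideal.finite_setOfPred_absNorm_le n

open Classical in
variable (K) in
noncomputable def T (x : ℝ) : Finset (Ideal (𝓞 K)) :=
  (finite_le K ⌊x⌋₊).toFinset.filter Prime

open Classical in
variable (K) in
noncomputable def F (x : ℝ) : Finset (Ideal (𝓞 K)) :=
  (finite_le K ⌊x⌋₊).toFinset.filter (· ≠ ⊥)

lemma mem_T {x : ℝ} {I : Ideal (𝓞 K)} : I ∈ T K x ↔ Ideal.absNorm I ≤ ⌊x⌋₊ ∧ Prime I := by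
  simp [T]

lemma mem_F {x : ℝ} {I : Ideal (𝓞 K)} : I ∈ F K x ↔ Ideal.absNorm I ≤ ⌊x⌋₊ ∧ I ≠ ⊥ := by
  simp [F]

lemma sum_F (x : ℝ) : ∑ n ∈ Finset.range (⌊x⌋₊ + 1), a K n * (n : ℝ) ^ (-1 : ℝ) =
    ∑ I ∈ F K x, (Ideal.absNorm I : ℝ) ^ (-1 : ℝ) := by
  classical
  rw [← Finset.sum_fiberwise_of_maps_to (s := F K x) (t := Finset.range (⌊x⌋₊ + 1))
      (g := Ideal.absNorm) (fun I hI ↦ by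
        have := (mem_F.mp hI).1
        simp; omega)]
  refine Finset.sum_congr rfl fun n hn ↦ ?_
  rcases Nat.eq_zero_or_pos n with rfl | hn0
  · rw [Nat.cast_zero, Real.zero_rpow (by norm_num), mul_zero]
    symm
    refine Finset.sum_eq_zero fun I hI ↦ ?_
    rw [(Finset.mem_filter.mp hI).2, Nat.cast_zero, Real.zero_rpow (by norm_num)]
  · rw [Finset.sum_congr rfl (g := fun _ ↦ (n:ℝ) ^ (-1:ℝ)) (fun I hI ↦ by
      rw [(Finset.mem_filter.mp hI).2]), Finset.sum_const, nsmul_eq_mul]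
    congr 1
    rw [a, Nat.cast_inj]
    have : Nat.card {I : Ideal (𝓞 K) // Ideal.absNorm I = n} =
      {I : Ideal (𝓞 K) | Ideal.absNorm I = n}.ncard := rfl
    rw [this, ← Set.ncard_coe_finset]
    congr 1
    ext I
    have hn' := Finset.mem_range.mp hn
    simp only [Set.mem_ofPred_eq, Finset.coe_filter, mem_F]
    constructor
    · intro h
      refine ⟨⟨by omega, ?_⟩, h⟩
      rintro rfl
      simp at h
      omega
    · exact fun h ↦ h.2

variable (K) in
lemma P_lower : ∃ C : ℝ, ∀ᶠ x : ℝ in atTop,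
    Real.log (Real.log x) + C ≤ ∑ I ∈ T K x, (Ideal.absNorm I : ℝ) ^ (-1 : ℝ) := by
  obtain ⟨c, hc, h⟩ := S_lower K
  refine ⟨Real.log c - Real.log (Z K 2), ?_⟩
  filter_upwards [h, eventually_gt_atTop 1] with x h hx
  have hL := Real.log_pos hx
  rw [sum_F] at h
  have h2 := lower (F K x) (T K x) (fun I hI ↦ (mem_F.mp hI).2) (fun P hP I hI hd ↦ by
    refine mem_T.mpr ⟨le_trans ?_ (mem_F.mp hI).1, hP⟩
    refine Nat.le_of_dvd ?_ (map_dvd Ideal.absNorm hd)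
    have := (mem_F.mp hI).2
    rw [Nat.pos_iff_ne_zero, Ne, Ideal.absNorm_eq_zero_iff]
    exact this)
  have h3 : ∏ P ∈ T K x, (1 + (Ideal.absNorm P : ℝ) ^ (-1 : ℝ)) ≤
      Real.exp (∑ I ∈ T K x, (Ideal.absNorm I : ℝ) ^ (-1 : ℝ)) := by
    rw [Real.exp_sum]
    refine Finset.prod_le_prod (fun _ _ ↦ by positivity) fun I _ ↦ ?_
    rw [add_comm]
    exact Real.add_one_le_exp _
  have hZ0 : 0 ≤ Z K 2 := tsum_nonneg (term_nonneg K 2)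
  have h4 := (h.trans h2).trans (mul_le_mul_of_nonneg_left h3 hZ0)
  have hcL : 0 < c * Real.log x := by positivity
  have hZ : 0 < Z K 2 := by
    rcases hZ0.eq_or_lt with h0 | h0
    · rw [← h0, zero_mul] at h4
      linarith
    · exact h0
  have h5 := Real.log_le_log hcL h4
  rw [Real.log_mul hc.ne' hL.ne', Real.log_mul hZ.ne' (Real.exp_pos _).ne', Real.log_exp] at h5
  linarith

variable (K) in
lemma P_upper {δ : ℝ} (hδ : 0 < δ) : ∃ C : ℝ, ∀ᶠ x : ℝ in atTop,
    ∑ I ∈ T K x, (Ideal.absNorm I : ℝ) ^ (-1 : ℝ) ≤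
      Real.exp δ * (Real.log (Real.log x) + C) := by
  have hc := dedekindZeta_residue_pos K
  have h1 := (Z_shift K hδ).eventually
    (gt_mem_nhds (show dedekindZeta_residue K < 2 * dedekindZeta_residue K by linarith))
  have h0 := (Z_shift K hδ).eventually (lt_mem_nhds hc)
  set c := dedekindZeta_residue K
  refine ⟨Real.log (2 * c / δ) + Z K 2, ?_⟩
  filter_upwards [h0, h1, eventually_gt_atTop 1] with x h0 h1 hx
  have hL := Real.log_pos hx
  set L := Real.log x with hLdef
  have hs : 1 < 1 + δ / L := by have : 0 < δ / L := by positivity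
                                linarith
  have hZ : 0 < Z K (1 + δ / L) := pos_of_mul_pos_right h0 (by positivity)
  have h1' : Z K (1 + δ / L) ≤ L * (2 * c / δ) := by
    rw [div_mul_eq_mul_div, div_lt_iff₀ hL] at h1
    rw [← mul_div_assoc, le_div_iff₀ hδ]
    linarith
  have h2 := Real.log_le_log hZ h1'
  rw [Real.log_mul hL.ne' (by positivity)] at h2
  have h3 := upper hs (T K x) (fun I hI ↦ (mem_T.mp hI).2)
  have h4 : ∑ I ∈ T K x, (Ideal.absNorm I : ℝ) ^ (-1 : ℝ) ≤
      Real.exp δ * ∑ I ∈ T K x, (Ideal.absNorm I : ℝ) ^ (-(1 + δ / L)) := by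
    rw [Finset.mul_sum]
    refine Finset.sum_le_sum fun I hI ↦ ?_
    obtain ⟨hI1, hI2⟩ := mem_T.mp hI
    have hn : (1 : ℝ) ≤ Ideal.absNorm I := one_le_norm hI2.ne_zero
    have hx' : (Ideal.absNorm I : ℝ) ≤ x := (Nat.le_floor_iff (by linarith)).mp hI1
    rw [rpow_shift hx (by linarith)]
    have : Real.log (Ideal.absNorm I) / L ≤ 1 := by
      rw [div_le_one hL]
      exact Real.log_le_log (by linarith) hx'
    have h5 : 1 ≤ Real.exp δ * Real.exp (-(δ * (Real.log (Ideal.absNorm I) / L))) := by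
      rw [← Real.exp_add]
      apply Real.one_le_exp
      nlinarith
    have h6 : 0 ≤ (Ideal.absNorm I : ℝ) ^ (-1 : ℝ) := by positivity
    nlinarith
  refine h4.trans (mul_le_mul_of_nonneg_left ?_ (Real.exp_pos _).le)
  linarith

lemma tsum_eq (x : ℝ) (hx : 0 ≤ x) :
    (∑' 𝔭 : {I : Ideal (𝓞 K) // I.IsPrime ∧ I ≠ ⊥ ∧ (Ideal.absNorm I : ℝ) ≤ x},
          (1 : ℝ) / (Ideal.absNorm 𝔭.1 : ℝ))
      = ∑ I ∈ T K x, (Ideal.absNorm I : ℝ) ^ (-1 : ℝ) := by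
  have hset : {I : Ideal (𝓞 K) | I.IsPrime ∧ I ≠ ⊥ ∧ (Ideal.absNorm I : ℝ) ≤ x}
      = (T K x : Set (Ideal (𝓞 K))) := by
    ext I
    simp only [Set.mem_ofPred_eq, Finset.mem_coe, mem_T, Nat.le_floor_iff hx]
    constructor
    · rintro ⟨h1, h2, h3⟩
      exact ⟨h3, Ideal.prime_of_isPrime h2 h1⟩
    · rintro ⟨h1, h2⟩
      exact ⟨Ideal.isPrime_of_prime h2, h2.ne_zero, h1⟩
  have h1 : (∑' 𝔭 : {I : Ideal (𝓞 K) // I.IsPrime ∧ I ≠ ⊥ ∧ (Ideal.absNorm I : ℝ) ≤ x},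
          (1 : ℝ) / (Ideal.absNorm 𝔭.1 : ℝ))
      = ∑' 𝔭 : ({I : Ideal (𝓞 K) | I.IsPrime ∧ I ≠ ⊥ ∧ (Ideal.absNorm I : ℝ) ≤ x} : Set _),
          (1 : ℝ) / (Ideal.absNorm (𝔭 : Ideal (𝓞 K)) : ℝ) := rfl
  rw [h1, hset, Finset.tsum_subtype' (T K x) (fun I ↦ (1 : ℝ) / (Ideal.absNorm I : ℝ))]
  refine Finset.sum_congr rfl fun I _ ↦ ?_
  rw [Real.rpow_neg_one, one_div]

end MertensAux

/-- Mertens' theorem for number fields (consequence of the prime ideal theorem):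
`∑_{N𝔭 ≤ x} 1/N𝔭 ∼ log log x` as `x → ∞`. -/
theorem mertens_prime_ideals
    (K : Type*) [Field K] [NumberField K] :
    Tendsto (fun x : ℝ =>
        (∑' 𝔭 : {I : Ideal (𝓞 K) // I.IsPrime ∧ I ≠ ⊥ ∧ (Ideal.absNorm I : ℝ) ≤ x},
          (1 : ℝ) / (Ideal.absNorm 𝔭.1 : ℝ)) / Real.log (Real.log x))
      atTop (nhds 1) := by
  have hll : Tendsto (fun x : ℝ ↦ Real.log (Real.log x)) atTop atTop :=
    Real.tendsto_log_atTop.comp Real.tendsto_log_atTop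
  have hlim : ∀ C : ℝ, Tendsto (fun x : ℝ ↦ 1 + C / Real.log (Real.log x)) atTop (nhds 1) := by
    intro C
    simpa using (hll.const_div_atTop C).const_add 1
  rw [tendsto_order]
  constructor
  · intro b hb
    obtain ⟨C, hC⟩ := MertensAux.P_lower K
    filter_upwards [hC, (hlim C).eventually (lt_mem_nhds hb), hll.eventually_gt_atTop 0,
      eventually_ge_atTop 0] with x h1 h2 h3 h4
    rw [MertensAux.tsum_eq x h4]
    refine lt_of_lt_of_le h2 ?_
    rw [le_div_iff₀ h3, add_mul, div_mul_cancel₀ _ h3.ne', one_mul]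
    exact h1
  · intro b hb
    obtain ⟨δ, hδ, hδb⟩ : ∃ δ : ℝ, 0 < δ ∧ Real.exp δ < b :=
      ⟨Real.log b / 2, by have := Real.log_pos hb; positivity, by
        rw [← Real.lt_log_iff_exp_lt (by linarith)]
        have := Real.log_pos hb
        linarith⟩
    obtain ⟨C, hC⟩ := MertensAux.P_upper K hδ
    have h5 := (hlim C).const_mul (Real.exp δ)
    rw [mul_one] at h5
    filter_upwards [hC, h5.eventually (gt_mem_nhds hδb), hll.eventually_gt_atTop 0,
      eventually_ge_atTop 0] with x h1 h2 h3 h4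
    rw [MertensAux.tsum_eq x h4]
    refine lt_of_le_of_lt ?_ h2
    rw [div_le_iff₀ h3, mul_assoc, add_mul, div_mul_cancel₀ _ h3.ne', one_mul]
    exact h1
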